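/- Let M be an L-structure, V and W definable sets in M, and R ⊆ V × W a definable relation (all definable with parameters from M), and suppose R is k-stable for some natural number k. Let μ be a Keisler measure on V over M. Then for every ε > 0 there are finite partitions V = V₁ ∪ … ∪ V_n and W = W₁ ∪ … ∪ W_m into M-definable sets such that for all i ≤ n and j ≤ m: either μ(V_i ∖ R_b) ≤ ε·μ(V_i) for all b ∈ W_j, or μ(V_i ∩ R_b) ≤ ε·μ(V_i) for all b ∈ W_j, where R_b = {a ∈ V : (a,b) ∈ R}. Moreover each V_i can be taken to lie in the Boolean algebra of subsets of V generated by the fibers R_b (b ∈ W), and each W_j in the Boolean algebra of subsets of W generated by the sets R^a = {b ∈ W : (a,b) ∈ R} (a ∈ V). -/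

import Mathlib

/-!
STATEMENT 11: Strong stable regularity for Keisler measures.  If `(V, W, R)` is a
bipartite graph definable in a structure `M` with `R` `k`-stable, and `μ` is a
Keisler measure on `V` over `M`, then for every `ε > 0` there are finite partitions
of `V` and `W` into `M`-definable sets such that every pair of parts is
`ε`-homogeneous in `μ`-measure; moreover, the parts of `V` can be taken in the
Boolean algebra generated by the fibers `R_b` (`b ∈ W`), and the parts of `W` in the
Boolean algebra generated by the sets `R^a` (`a ∈ V`).
-/

open FirstOrder

universe u v w

/-- `R` is `k`-stable: there is no half-graph of height `k`. -/
def IsKStable {X Y : Type*} (R : X → Y → Prop) (k : ℕ) : Prop :=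
  ¬∃ (a : Fin k → X) (b : Fin k → Y), ∀ i j, R (a i) (b j) ↔ i ≤ j

/-- The Boolean algebra of subsets of the ambient set `V` generated by a family `S`
of subsets of `V`: it contains `V` and is closed under relative complementation and
intersection. -/
inductive RelBoolAlg {X : Type*} (V : Set X) (S : Set (Set X)) : Set X → Prop
  | basic {A : Set X} : A ∈ S → RelBoolAlg V S A
  | top : RelBoolAlg V S V
  | compl {A : Set X} : RelBoolAlg V S A → RelBoolAlg V S (V \ A)
  | inter {A B : Set X} : RelBoolAlg V S A → RelBoolAlg V S B → RelBoolAlg V S (A ∩ B)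

/-- `s ⊆ M` is definable by an `L`-formula in one free variable with parameters from `P`. -/
def DefOver (L : FirstOrder.Language.{u, v}) (M : Type w) [L.Structure M]
    (P : Set M) (s : Set M) : Prop :=
  ∃ (k : ℕ) (φ : L.Formula (Unit ⊕ Fin k)) (c : Fin k → M),
    (∀ j, c j ∈ P) ∧ s = {a | φ.Realize (Sum.elim (fun _ => a) c)}

/-- `r : M → M → Prop` is definable with parameters from `P`. -/
def DefRelOver (L : FirstOrder.Language.{u, v}) (M : Type w) [L.Structure M]
    (P : Set M) (r : M → M → Prop) : Prop :=
  ∃ (k : ℕ) (φ : L.Formula ((Unit ⊕ Unit) ⊕ Fin k)) (c : Fin k → M),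
    (∀ j, c j ∈ P) ∧
    ∀ a b, r a b ↔ φ.Realize (Sum.elim (Sum.elim (fun _ => a) (fun _ => b)) c)

/-- A Keisler measure on the definable set `V` over `M`. -/
def IsKeislerMeasureOn (L : FirstOrder.Language.{u, v}) (M : Type w) [L.Structure M]
    (V : Set M) (μ : Set M → ℝ) : Prop :=
  (∀ s, DefOver L M Set.univ s → s ⊆ V → 0 ≤ μ s) ∧ μ V = 1 ∧
    ∀ s t, DefOver L M Set.univ s → DefOver L M Set.univ t → s ⊆ V → t ⊆ V →
      Disjoint s t → μ (s ∪ t) = μ s + μ t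

open MeasureTheory

section StableRelation

variable {α β : Type*} {R : α → β → Prop} {k : ℕ}

/-- An infinite ladder of mixed orientations contains half-graphs of every height. -/
theorem IsKStable.false_of_ladder (hR : IsKStable R k) (a : ℕ → α) (b : ℕ → β) (c : ℕ → Prop)
    (hle : ∀ i j, i ≤ j → (R (a i) (b j) ↔ c i))
    (hlt : ∀ i j, i < j → (R (a j) (b i) ↔ ¬c i)) : False := by
  by_cases hc : ∃ᶠ n in Filter.atTop, c n
  · obtain ⟨φ, hφ, hφc⟩ := Filter.extraction_of_frequently_atTop hc
    refine hR ⟨fun i => a (φ i), fun j => b (φ j), fun i j => ?_⟩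
    rcases le_or_gt i j with h | h
    · simp [hle _ _ (hφ.monotone (Fin.le_def.1 h)), hφc, h]
    · simp [hlt _ _ (hφ (Fin.lt_def.1 h)), hφc, h]
  · have hc' : ∃ᶠ n in Filter.atTop, ¬c n :=
      (Filter.not_frequently.1 hc).frequently
    obtain ⟨φ, hφ, hφc⟩ := Filter.extraction_of_frequently_atTop hc'
    refine hR ⟨fun i => a (φ (k - i)), fun j => b (φ (k - 1 - j)), fun i j => ?_⟩
    have hi := i.2
    have hj := j.2
    rcases le_or_gt i j with h | h
    · have h' : (i : ℕ) ≤ j := h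
      have : k - 1 - (j : ℕ) < k - i := by omega
      simp [hlt _ _ (hφ this), hφc, h]
    · have h' : (j : ℕ) < i := h
      have : k - (i : ℕ) ≤ k - 1 - j := by omega
      simp [hle _ _ (hφ.monotone this), hφc, h]

/-- A stable relation cannot split hereditarily all members of a nonempty family of
nonempty sets closed under supersets. -/
theorem IsKStable.exists_not_split (hR : IsKStable R k) (P : Set α → Prop)
    (hmono : Monotone P) (hP : ∀ A, P A → A.Nonempty) {A : Set α} (hA : P A) :
    ∃ A, P A ∧ ∀ b, ¬(P (A ∩ {a | R a b}) ∧ P (A \ {a | R a b})) := by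
  by_contra! hsplit
  let H : Set α × Set β → Prop := fun S =>
    P S.1 ∧ ∀ A ⊆ S.1, P A → ∃ b ∈ S.2, P (A ∩ {a | R a b}) ∧ P (A \ {a | R a b})
  have step : ∀ S : {S // H S}, ∃ (a : α) (b : β) (c : Prop) (T : {T // H T}),
      T.1.1 ⊆ S.1.1 ∧ T.1.2 ⊆ S.1.2 ∧ a ∈ S.1.1 ∧ b ∈ T.1.2 ∧
      (∀ b' ∈ T.1.2, R a b' ↔ c) ∧ ∀ a' ∈ T.1.1, R a' b ↔ ¬c := by
    rintro ⟨⟨A, X⟩, hPA, hX⟩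
    obtain ⟨a, ha⟩ := hP A hPA
    have key : ∃ c : Prop, ∃ A' ⊆ A, H (A', {b ∈ X | R a b ↔ c}) := by
      by_cases h : H (A, {b ∈ X | R a b ↔ True})
      · exact ⟨True, A, subset_rfl, h⟩
      · simp only [H, not_and, not_forall] at h
        obtain ⟨A', hA', hPA', hno⟩ := h hPA
        refine ⟨False, A', hA', hPA', fun A'' hA'' hPA'' => ?_⟩
        obtain ⟨b, hb, h1, h2⟩ := hX A'' (hA''.trans hA') hPA''
        refine ⟨b, ⟨hb, iff_false_intro fun hRab => ?_⟩, h1, h2⟩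
        exact hno ⟨b, ⟨hb, iff_true_intro hRab⟩, hmono (Set.inter_subset_inter_left _ hA'') h1,
          hmono (Set.sdiff_subset_sdiff_left hA'') h2⟩
    obtain ⟨c, A', hA', hPA', hX'⟩ := key
    obtain ⟨b, hb, h1, h2⟩ := hX' A' subset_rfl hPA'
    by_cases hc : c
    · refine ⟨a, b, c, ⟨(A' \ {a | R a b}, {b ∈ X | R a b ↔ c}), h2, fun A'' h => ?_⟩,
        Set.sdiff_subset.trans hA', Set.sep_subset _ _, ha, hb, fun b' hb' => hb'.2, ?_⟩
      · exact hX' A'' (h.trans Set.sdiff_subset)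
      · rintro a' ⟨-, h⟩
        simpa [hc] using h
    · refine ⟨a, b, c, ⟨(A' ∩ {a | R a b}, {b ∈ X | R a b ↔ c}), h1, fun A'' h => ?_⟩,
        Set.inter_subset_left.trans hA', Set.sep_subset _ _, ha, hb, fun b' hb' => hb'.2, ?_⟩
      · exact hX' A'' (h.trans Set.inter_subset_left)
      · rintro a' ⟨-, h⟩
        simpa [hc] using h
  choose fa fb fc next hn1 hn2 hfa hfb hfc hfc' using step
  let s : ℕ → {S // H S} := fun n =>
    next^[n] ⟨(A, Set.univ), hA, fun A' _ hA' => by simpa using hsplit A' hA'⟩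
  have hs : ∀ n, s (n + 1) = next (s n) := fun n => Function.iterate_succ_apply' _ _ _
  have hs1 : Antitone fun n => (s n).1.1 := antitone_nat_of_succ_le fun n => by
    simpa only [hs] using hn1 (s n)
  have hs2 : Antitone fun n => (s n).1.2 := antitone_nat_of_succ_le fun n => by
    simpa only [hs] using hn2 (s n)
  refine hR.false_of_ladder (fun n => fa (s n)) (fun n => fb (s n)) (fun n => fc (s n))
    (fun i j h => ?_) (fun i j h => ?_)
  · refine hfc _ _ ?_
    have := hs2 (Nat.succ_le_succ h)
    simp only [Nat.succ_eq_add_one, hs] at this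
    exact this (hfb _)
  · refine hfc' _ _ ?_
    have := hs1 (Nat.succ_le_of_lt h)
    simp only [Nat.succ_eq_add_one, hs] at this
    exact this (hfa _)

/-- There is no ladder between two sets across which `R` has opposite limits. -/
theorem IsKStable.false_of_finset_exists (hR : IsKStable R k) (E : Set α) (D : Set β) (c : Prop)
    (hE : ∀ G : Finset β, (∀ b ∈ G, b ∈ D) → ∃ a ∈ E, ∀ b ∈ G, R a b ↔ ¬c)
    (hD : ∀ F : Finset α, (∀ a ∈ F, a ∈ E) → ∃ b ∈ D, ∀ a ∈ F, R a b ↔ c) : False := by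
  classical
  obtain ⟨f, hf, hf'⟩ := exists_seq_of_forall_finset_exists
    (fun x : α × β => x.1 ∈ E ∧ x.2 ∈ D ∧ (R x.1 x.2 ↔ c))
    (fun x y => (R x.1 y.2 ↔ c) ∧ (R y.1 x.2 ↔ ¬c)) (fun S hS => by
      obtain ⟨a, ha, ha'⟩ := hE (S.image Prod.snd) (by
        simp only [Finset.forall_mem_image]
        exact fun x hx => (hS x hx).2.1)
      obtain ⟨b, hb, hb'⟩ := hD (insert a (S.image Prod.fst)) (by
        simp only [Finset.forall_mem_insert, Finset.forall_mem_image]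
        exact ⟨ha, fun x hx => (hS x hx).1⟩)
      simp only [Finset.forall_mem_insert, Finset.forall_mem_image] at ha' hb'
      exact ⟨(a, b), ⟨ha, hb, hb'.1⟩, fun x hx => ⟨hb'.2 hx, ha' hx⟩⟩)
  refine hR.false_of_ladder (fun n => (f n).1) (fun n => (f n).2) (fun _ => c)
    (fun i j h => ?_) (fun i j h => (hf' i j h).2)
  rcases h.eq_or_lt with rfl | h
  · exact (hf i).2.2
  · exact (hf' i j h).1

/-- Definability of types for a stable relation: if the pattern `D` is finitely satisfiable then
membership in `D` only depends on the trace on some finite set. -/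
theorem IsKStable.exists_finset_determining (hR : IsKStable R k) (D : Set β)
    (hD : ∀ G : Finset β, ∃ a, ∀ b ∈ G, R a b ↔ b ∈ D) :
    ∃ F : Finset α, ∀ b b', (∀ a ∈ F, R a b ↔ R a b') → (b ∈ D ↔ b' ∈ D) := by
  classical
  by_contra! hno
  have hno' : ∀ F : Finset α, ∃ x y, (∀ a ∈ F, R a x ↔ R a y) ∧ x ∈ D ∧ y ∉ D := by
    intro F
    obtain ⟨b, b', h, h1 | h1⟩ := hno F
    · exact ⟨b, b', h, h1⟩
    · exact ⟨b', b, fun a ha => (h a ha).symm, h1.2, h1.1⟩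
  choose x y hxy hx hy using hno'
  let U : Ultrafilter (Finset α) := Ultrafilter.of Filter.atTop
  let E : Set α := {a | ∀ᶠ F in U, R a (x F)}
  have hxE : ∀ a, ∀ᶠ F in U, R a (x F) ↔ a ∈ E := fun a => by
    by_cases ha : a ∈ E
    · filter_upwards [show ∀ᶠ F in U, R a (x F) from ha] with F hF
      simp [hF, ha]
    · filter_upwards [Ultrafilter.eventually_not.2 ha] with F hF
      simp [hF, ha]
  have hyE : ∀ a, ∀ᶠ F in U, R a (y F) ↔ a ∈ E := fun a => by
    filter_upwards [hxE a, Ultrafilter.of_le _ (Filter.eventually_ge_atTop {a})] with F h1 h2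
    rw [← h1, hxy F a (h2 (Finset.mem_singleton_self a))]
  by_cases hE : ∀ G : Finset β, ∃ a ∈ E, ∀ b ∈ G, R a b ↔ b ∈ D
  · refine hR.false_of_finset_exists E Dᶜ True (fun G hG => ?_) (fun F hF => ?_)
    · obtain ⟨a, ha, h⟩ := hE G
      exact ⟨a, ha, fun b hb => by simpa [show b ∉ D from hG b hb] using h b hb⟩
    · obtain ⟨S, hS⟩ := ((Filter.eventually_all_finset F).2 fun a _ => hyE a).exists
      exact ⟨y S, hy S, fun a ha => by simpa [hF a ha] using hS a ha⟩
  · push Not at hE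
    obtain ⟨G₀, hG₀⟩ := hE
    refine hR.false_of_finset_exists Eᶜ D False (fun G hG => ?_) (fun F hF => ?_)
    · obtain ⟨a, h⟩ := hD (G₀ ∪ G)
      refine ⟨a, fun ha => ?_, fun b hb => by simpa [hG b hb] using h b (by simp [hb])⟩
      obtain ⟨b, hb, hb'⟩ := hG₀ a ha
      have := h b (by simp [hb])
      tauto
    · obtain ⟨S, hS⟩ := ((Filter.eventually_all_finset F).2 fun a _ => hxE a).exists
      exact ⟨x S, hx S, fun a ha => by simpa [show a ∉ E from hF a ha] using hS a ha⟩

end StableRelation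

section Measure

variable {α β : Type*} {R : α → β → Prop} {k : ℕ} {𝓑 : Set (Set α)} {μ : Set α → ℝ}

/-- `μ` is a nonnegative finitely additive function on `𝓑`. -/
structure IsFinAdd (𝓑 : Set (Set α)) (μ : Set α → ℝ) : Prop where
  nonneg : ∀ A ∈ 𝓑, 0 ≤ μ A
  add : ∀ A ∈ 𝓑, ∀ C ∈ 𝓑, Disjoint A C → μ (A ∪ C) = μ A + μ C

namespace IsFinAdd

theorem empty (hμ : IsFinAdd 𝓑 μ) (h𝓑 : IsSetRing 𝓑) : μ ∅ = 0 := by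
  simpa using hμ.add ∅ h𝓑.empty_mem ∅ h𝓑.empty_mem (by simp)

theorem inter_add_sdiff (hμ : IsFinAdd 𝓑 μ) (h𝓑 : IsSetRing 𝓑) {A C : Set α} (hA : A ∈ 𝓑)
    (hAC : A ∩ C ∈ 𝓑) : μ (A ∩ C) + μ (A \ C) = μ A := by
  have h : A \ C ∈ 𝓑 := by simpa using h𝓑.sdiff_mem hA hAC
  rw [← hμ.add _ hAC _ h (Set.disjoint_sdiff_inter.symm), Set.inter_union_sdiff]

theorem mono (hμ : IsFinAdd 𝓑 μ) (h𝓑 : IsSetRing 𝓑) {A C : Set α} (hA : A ∈ 𝓑) (hC : C ∈ 𝓑)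
    (h : A ⊆ C) : μ A ≤ μ C := by
  have := hμ.inter_add_sdiff h𝓑 hC (C := A) (h𝓑.inter_mem hC hA)
  rw [Set.inter_eq_self_of_subset_right h] at this
  linarith [hμ.nonneg _ (h𝓑.sdiff_mem hC hA)]

theorem union_le (hμ : IsFinAdd 𝓑 μ) (h𝓑 : IsSetRing 𝓑) {A C : Set α} (hA : A ∈ 𝓑)
    (hC : C ∈ 𝓑) : μ (A ∪ C) ≤ μ A + μ C := by
  rw [← Set.union_sdiff_self, hμ.add _ hA _ (h𝓑.sdiff_mem hC hA) Set.disjoint_sdiff_right]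
  linarith [hμ.mono h𝓑 (h𝓑.sdiff_mem hC hA) hC Set.sdiff_subset]

theorem exists_pos (hμ : IsFinAdd 𝓑 μ) (h𝓑 : IsSetRing 𝓑) {𝓕 : Finset (Set α)}
    (h𝓕 : ∀ C ∈ 𝓕, C ∈ 𝓑) (hpos : 0 < μ (⋃ C ∈ 𝓕, C)) : ∃ C ∈ 𝓕, 0 < μ C := by
  classical
  induction 𝓕 using Finset.induction_on with
  | empty => simp [hμ.empty h𝓑] at hpos
  | insert A 𝓕 _ ih =>
    rw [Finset.forall_mem_insert] at h𝓕
    rw [Finset.set_biUnion_insert] at hpos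
    have := hμ.union_le h𝓑 h𝓕.1 (h𝓑.biUnion_mem 𝓕 h𝓕.2)
    by_cases hA : 0 < μ A
    · exact ⟨A, by simp, hA⟩
    · obtain ⟨C, hC, h⟩ := ih h𝓕.2 (by linarith)
      exact ⟨C, by simp [hC], h⟩

end IsFinAdd

/-- `A` is `ε`-homogeneous with respect to all fibers, and whether a fiber is large in `A`
only depends on its trace on a finite set. -/
def IsDefinablyHomogeneous (R : α → β → Prop) (μ : Set α → ℝ) (ε : ℝ) (A : Set α) : Prop :=
  ∃ (D : Set β) (F : Finset α), (∀ b b', (∀ a ∈ F, R a b ↔ R a b') → (b ∈ D ↔ b' ∈ D)) ∧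
    (∀ b ∈ D, μ (A \ {a | R a b}) ≤ ε * μ A) ∧ ∀ b ∉ D, μ (A ∩ {a | R a b}) ≤ ε * μ A

/-- `𝓕` is a finite family of disjoint members of `𝓑`, all with property `G`. -/
structure IsPacking (𝓑 : Set (Set α)) (G : Set α → Prop) (𝓕 : Finset (Set α)) : Prop where
  mem : ∀ C ∈ 𝓕, C ∈ 𝓑
  prop : ∀ C ∈ 𝓕, G C
  disjoint : (𝓕 : Set (Set α)).PairwiseDisjoint id

theorem IsPacking.union [DecidableEq (Set α)] {G : Set α → Prop} {𝓕 𝓖 : Finset (Set α)}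
    (h𝓕 : IsPacking 𝓑 G 𝓕) (h𝓖 : IsPacking 𝓑 G 𝓖)
    (h : Disjoint (⋃ C ∈ 𝓕, C) (⋃ C ∈ 𝓖, C)) : IsPacking 𝓑 G (𝓕 ∪ 𝓖) where
  mem C hC := (Finset.mem_union.1 hC).elim (h𝓕.mem C) (h𝓖.mem C)
  prop C hC := (Finset.mem_union.1 hC).elim (h𝓕.prop C) (h𝓖.prop C)
  disjoint := by
    rw [Finset.coe_union]
    refine h𝓕.disjoint.union h𝓖.disjoint fun A hA C hC _ => ?_
    exact h.mono (Set.subset_biUnion_of_mem (u := id) hA) (Set.subset_biUnion_of_mem (u := id) hC)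

theorem isPacking_singleton {G : Set α → Prop} {A : Set α} (hA : A ∈ 𝓑) (hGA : G A) :
    IsPacking 𝓑 G {A} where
  mem := by simpa
  prop := by simpa
  disjoint := by simp

/-- `A` can be exhausted up to arbitrarily small measure by packings. -/
def IsExhaustible (𝓑 : Set (Set α)) (μ : Set α → ℝ) (G : Set α → Prop) (A : Set α) : Prop :=
  ∀ δ > 0, ∃ 𝓕, IsPacking 𝓑 G 𝓕 ∧ (⋃ C ∈ 𝓕, C) ⊆ A ∧ μ (A \ ⋃ C ∈ 𝓕, C) < δ

theorem IsExhaustible.union (hμ : IsFinAdd 𝓑 μ) (h𝓑 : IsSetRing 𝓑) {G : Set α → Prop}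
    {A A' : Set α} (hA : A ∈ 𝓑) (hA' : A' ∈ 𝓑) (hd : Disjoint A A')
    (h : IsExhaustible 𝓑 μ G A) (h' : IsExhaustible 𝓑 μ G A') :
    IsExhaustible 𝓑 μ G (A ∪ A') := by
  classical
  intro δ hδ
  obtain ⟨𝓕, h𝓕, hsub, hlt⟩ := h (δ / 2) (by positivity)
  obtain ⟨𝓕', h𝓕', hsub', hlt'⟩ := h' (δ / 2) (by positivity)
  refine ⟨𝓕 ∪ 𝓕', h𝓕.union h𝓕' (hd.mono hsub hsub'), ?_, ?_⟩
  · rw [Finset.set_biUnion_union]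
    exact Set.union_subset_union hsub hsub'
  · rw [Finset.set_biUnion_union]
    have hU := h𝓑.biUnion_mem 𝓕 h𝓕.mem
    have hU' := h𝓑.biUnion_mem 𝓕' h𝓕'.mem
    set U := ⋃ C ∈ 𝓕, C
    set U' := ⋃ C ∈ 𝓕', C
    have h1 := hμ.union_le h𝓑 (h𝓑.sdiff_mem hA hU) (h𝓑.sdiff_mem hA' hU')
    have h2 := hμ.mono h𝓑 (h𝓑.sdiff_mem (h𝓑.union_mem hA hA') (h𝓑.union_mem hU hU'))
      (h𝓑.union_mem (h𝓑.sdiff_mem hA hU) (h𝓑.sdiff_mem hA' hU')) (by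
        rintro x ⟨hx | hx, hxU⟩
        · exact Or.inl ⟨hx, fun h => hxU (Or.inl h)⟩
        · exact Or.inr ⟨hx, fun h => hxU (Or.inr h)⟩)
    linarith

theorem isExhaustible_empty (hμ : IsFinAdd 𝓑 μ) (h𝓑 : IsSetRing 𝓑) {G : Set α → Prop} :
    IsExhaustible 𝓑 μ G ∅ := fun δ hδ =>
  ⟨∅, ⟨by simp, by simp, by simp⟩, by simp, by simpa [hμ.empty h𝓑] using hδ⟩

theorem IsExhaustible.of_prop (hμ : IsFinAdd 𝓑 μ) (h𝓑 : IsSetRing 𝓑) {G : Set α → Prop}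
    {A : Set α} (hA : A ∈ 𝓑) (hGA : G A) : IsExhaustible 𝓑 μ G A := fun δ hδ =>
  ⟨{A}, isPacking_singleton hA hGA, by simp, by simpa [hμ.empty h𝓑] using hδ⟩

theorem isExhaustible_of_forall_lt (hμ : IsFinAdd 𝓑 μ) (h𝓑 : IsSetRing 𝓑) {G : Set α → Prop}
    {A : Set α} (hA : A ∈ 𝓑)
    (h : ∀ δ > 0, ∃ X ∈ 𝓑, X ⊆ A ∧ μ X < δ ∧ IsExhaustible 𝓑 μ G (A \ X)) :
    IsExhaustible 𝓑 μ G A := by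
  intro δ hδ
  obtain ⟨X, hX, hXA, hlt, hex⟩ := h δ hδ
  obtain ⟨𝓕, h𝓕, hsub, hlt'⟩ := hex (δ - μ X) (by linarith)
  refine ⟨𝓕, h𝓕, hsub.trans Set.sdiff_subset, ?_⟩
  have hU := h𝓑.biUnion_mem 𝓕 h𝓕.mem
  set U := ⋃ C ∈ 𝓕, C
  have hAXU := h𝓑.sdiff_mem (h𝓑.sdiff_mem hA hX) hU
  have h1 := hμ.union_le h𝓑 hX hAXU
  have h2 := hμ.mono h𝓑 (h𝓑.sdiff_mem hA hU) (h𝓑.union_mem hX hAXU) (by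
    rintro x ⟨hx, hxU⟩
    by_cases h : x ∈ X
    · exact Or.inl h
    · exact Or.inr ⟨⟨hx, h⟩, hxU⟩)
  linarith

theorem IsKStable.isExhaustible (hR : IsKStable R k) (hμ : IsFinAdd 𝓑 μ) (h𝓑 : IsSetRing 𝓑)
    (hsec : ∀ A ∈ 𝓑, ∀ b, A ∩ {a | R a b} ∈ 𝓑) {ε : ℝ} (hε : 0 < ε) {A : Set α} (hA : A ∈ 𝓑) :
    IsExhaustible 𝓑 μ (IsDefinablyHomogeneous R μ ε) A := by
  classical
  by_contra hAex
  set Ex := IsExhaustible 𝓑 μ (IsDefinablyHomogeneous R μ ε)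
  let P : Set α → Prop := fun A => ∃ C ∈ 𝓑, C ⊆ A ∧ ¬Ex C
  have hmono : Monotone P := fun A A' h ⟨C, hC, hCA, hne⟩ => ⟨C, hC, hCA.trans h, hne⟩
  have hPempty : ¬P ∅ := by
    rintro ⟨C, -, hC, hne⟩
    rw [Set.subset_empty_iff.1 hC] at hne
    exact hne (isExhaustible_empty hμ h𝓑)
  have hPunion : ∀ X ∈ 𝓑, ∀ Y, ¬P X → ¬P Y → ¬P (X ∪ Y) := by
    rintro X hX Y hPX hPY ⟨C, hC, hsub, hne⟩
    rw [← Set.inter_union_sdiff C X] at hne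
    refine hne (IsExhaustible.union hμ h𝓑 (h𝓑.inter_mem hC hX) (h𝓑.sdiff_mem hC hX)
      Set.disjoint_sdiff_inter.symm ?_ ?_)
    · by_contra h
      exact hPX ⟨_, h𝓑.inter_mem hC hX, Set.inter_subset_right, h⟩
    · by_contra h
      exact hPY ⟨_, h𝓑.sdiff_mem hC hX, fun x hx => (hsub hx.1).resolve_left hx.2, h⟩
  obtain ⟨A', ⟨C, hC, hCA', hCex⟩, hsplit⟩ := hR.exists_not_split P hmono
    (fun X hX => Set.nonempty_iff_ne_empty.2 fun h => hPempty (h ▸ hX)) (A := A)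
    ⟨A, hA, subset_rfl, hAex⟩
  have hsec' : ∀ X ∈ 𝓑, ∀ b, X \ {a | R a b} ∈ 𝓑 := fun X hX b => by
    simpa using h𝓑.sdiff_mem hX (hsec X hX b)
  let D : Set β := {b | P (C ∩ {a | R a b})}
  have hD : ∀ b ∈ D, ¬P (C \ {a | R a b}) := fun b hb h =>
    hsplit b ⟨hmono (Set.inter_subset_inter_left _ hCA') hb,
      hmono (Set.sdiff_subset_sdiff_left hCA') h⟩
  have hfin : ∀ G : Finset β, ∃ a, ∀ b ∈ G, R a b ↔ b ∈ D := by
    intro G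
    have key : ∃ X ∈ 𝓑, ¬P X ∧ ∀ a ∈ C, (∃ b ∈ G, ¬(R a b ↔ b ∈ D)) → a ∈ X := by
      induction G using Finset.induction_on with
      | empty => exact ⟨∅, h𝓑.empty_mem, hPempty, by simp⟩
      | insert b G _ ih =>
        obtain ⟨X, hX, hPX, hXC⟩ := ih
        by_cases hb : b ∈ D
        · refine ⟨_, h𝓑.union_mem hX (hsec' C hC b), hPunion X hX _ hPX (hD b hb), ?_⟩
          rintro a ha ⟨b', hb', hab⟩
          rcases Finset.mem_insert.1 hb' with rfl | hb'
          · exact Or.inr ⟨ha, by simpa [hb] using hab⟩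
          · exact Or.inl (hXC a ha ⟨b', hb', hab⟩)
        · refine ⟨_, h𝓑.union_mem hX (hsec C hC b), hPunion X hX _ hPX hb, ?_⟩
          rintro a ha ⟨b', hb', hab⟩
          rcases Finset.mem_insert.1 hb' with rfl | hb'
          · exact Or.inr ⟨ha, by simpa [hb] using hab⟩
          · exact Or.inl (hXC a ha ⟨b', hb', hab⟩)
    obtain ⟨X, -, hPX, hXC⟩ := key
    by_contra! hno
    refine hPX ⟨C, hC, fun a ha => hXC a ha ?_, hCex⟩
    obtain ⟨b, hb, h⟩ := hno a
    exact ⟨b, hb, by tauto⟩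
  obtain ⟨F, hF⟩ := hR.exists_finset_determining D hfin
  let S : Set (Set α) := {X | X ∈ 𝓑 ∧ X ⊆ C ∧ ¬P (C \ X)}
  have hCS : C ∈ S := ⟨hC, subset_rfl, by simpa using hPempty⟩
  have hbdd : BddBelow (μ '' S) := ⟨0, by
    rintro _ ⟨X, hX, rfl⟩
    exact hμ.nonneg X hX.1⟩
  have hex : ∀ X ∈ S, Ex (C \ X) := fun X hX => by
    by_contra h
    exact hX.2.2 ⟨_, h𝓑.sdiff_mem hC hX.1, subset_rfl, h⟩
  set s := sInf (μ '' S)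
  have hs : ∀ X ∈ S, s ≤ μ X := fun X hX => csInf_le hbdd ⟨X, hX, rfl⟩
  have hs' : ∀ t > s, ∃ X ∈ S, μ X < t := fun t ht => by
    obtain ⟨_, ⟨X, hX, rfl⟩, hlt⟩ := exists_lt_of_csInf_lt (Set.Nonempty.image μ ⟨C, hCS⟩) ht
    exact ⟨X, hX, hlt⟩
  rcases le_or_gt s 0 with h0 | h0
  · refine hCex (isExhaustible_of_forall_lt hμ h𝓑 hC fun δ hδ => ?_)
    obtain ⟨X, hX, hlt⟩ := hs' δ (h0.trans_lt hδ)
    exact ⟨X, hX.1, hX.2.1, hlt, hex X hX⟩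
  · obtain ⟨X, hX, hlt⟩ := hs' (s + ε * s) (by nlinarith)
    have hεs : ε * s ≤ ε * μ X := by
      gcongr
      exact hs X hX
    have hXgood : IsDefinablyHomogeneous R μ ε X := by
      refine ⟨D, F, hF, fun b hb => ?_, fun b hb => ?_⟩
      · have hmem : X ∩ {a | R a b} ∈ S := by
          refine ⟨hsec X hX.1 b, Set.inter_subset_left.trans hX.2.1, fun h => ?_⟩
          rw [Set.sdiff_inter] at h
          exact hPunion _ (h𝓑.sdiff_mem hC hX.1) _ hX.2.2 (hD b hb) h
        linarith [hs _ hmem, hμ.inter_add_sdiff h𝓑 hX.1 (hsec X hX.1 b)]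
      · have hmem : X \ {a | R a b} ∈ S := by
          refine ⟨hsec' X hX.1 b, Set.sdiff_subset.trans hX.2.1, fun h => ?_⟩
          refine hPunion _ (h𝓑.sdiff_mem hC hX.1) _ hX.2.2 hb (hmono ?_ h)
          intro a ha
          by_cases hXa : a ∈ X
          · exact Or.inr ⟨ha.1, by_contra fun h => ha.2 ⟨hXa, h⟩⟩
          · exact Or.inl ⟨ha.1, hXa⟩
        linarith [hs _ hmem, hμ.inter_add_sdiff h𝓑 hX.1 (hsec X hX.1 b)]
    refine hCex ?_
    rw [← Set.union_sdiff_cancel hX.2.1]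
    exact IsExhaustible.union hμ h𝓑 hX.1 (h𝓑.sdiff_mem hC hX.1) Set.disjoint_sdiff_right
      (IsExhaustible.of_prop hμ h𝓑 hX.1 hXgood) (hex X hX)

/-- Absorbing a set of small measure preserves homogeneity. -/
theorem IsDefinablyHomogeneous.union (hμ : IsFinAdd 𝓑 μ) (h𝓑 : IsSetRing 𝓑)
    (hsec : ∀ A ∈ 𝓑, ∀ b, A ∩ {a | R a b} ∈ 𝓑) {ε : ℝ} (hε : 0 < ε) {A E : Set α} (hA : A ∈ 𝓑)
    (hE : E ∈ 𝓑) (hEA : μ E ≤ ε * μ A) (h : IsDefinablyHomogeneous R μ ε A) :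
    IsDefinablyHomogeneous R μ (2 * ε) (A ∪ E) := by
  have hsec' : ∀ X ∈ 𝓑, ∀ b, X \ {a | R a b} ∈ 𝓑 := fun X hX b => by
    simpa using h𝓑.sdiff_mem hX (hsec X hX b)
  obtain ⟨D, F, hF, h1, h2⟩ := h
  have hle : 2 * ε * μ A ≤ 2 * ε * μ (A ∪ E) := by
    gcongr
    exact hμ.mono h𝓑 hA (h𝓑.union_mem hA hE) Set.subset_union_left
  refine ⟨D, F, hF, fun b hb => ?_, fun b hb => ?_⟩
  · rw [Set.union_sdiff_distrib]
    have h3 := hμ.union_le h𝓑 (hsec' A hA b) (hsec' E hE b)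
    have h4 := hμ.mono h𝓑 (hsec' E hE b) hE Set.sdiff_subset
    linarith [h1 b hb]
  · rw [Set.union_inter_distrib_right]
    have h3 := hμ.union_le h𝓑 (hsec A hA b) (hsec E hE b)
    have h4 := hμ.mono h𝓑 (hsec E hE b) hE Set.inter_subset_left
    linarith [h2 b hb]

theorem IsKStable.exists_packing_eq (hR : IsKStable R k) (hμ : IsFinAdd 𝓑 μ) (h𝓑 : IsSetRing 𝓑)
    (hsec : ∀ A ∈ 𝓑, ∀ b, A ∩ {a | R a b} ∈ 𝓑) {ε : ℝ} (hε : 0 < ε) {A : Set α} (hA : A ∈ 𝓑)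
    (hpos : 0 < μ A) :
    ∃ 𝓕, IsPacking 𝓑 (IsDefinablyHomogeneous R μ (2 * ε)) 𝓕 ∧ (⋃ C ∈ 𝓕, C) = A := by
  classical
  obtain ⟨𝓕, h𝓕, hsub, hlt⟩ := hR.isExhaustible hμ h𝓑 hsec hε hA _ hpos
  have hU := h𝓑.biUnion_mem 𝓕 h𝓕.mem
  have h1 := hμ.inter_add_sdiff h𝓑 hA (h𝓑.inter_mem hA hU)
  rw [Set.inter_eq_self_of_subset_right hsub] at h1
  obtain ⟨C, hC𝓕, hCpos⟩ := hμ.exists_pos h𝓑 h𝓕.mem (by linarith)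
  have hC := h𝓕.mem C hC𝓕
  have hCA : C ⊆ A := (Set.subset_biUnion_of_mem (u := id) hC𝓕).trans hsub
  obtain ⟨𝓖, h𝓖, hsub', hlt'⟩ := hR.isExhaustible hμ h𝓑 hsec hε (h𝓑.sdiff_mem hA hC)
    (ε * μ C) (by positivity)
  have hU' := h𝓑.biUnion_mem 𝓖 h𝓖.mem
  have hE := h𝓑.sdiff_mem (h𝓑.sdiff_mem hA hC) hU'
  have hCE := (h𝓕.prop C hC𝓕).union hμ h𝓑 hsec hε hC hE hlt'.le
  have h𝓖' : IsPacking 𝓑 (IsDefinablyHomogeneous R μ (2 * ε)) 𝓖 :=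
    ⟨h𝓖.mem, fun X hX => by
      simpa using (h𝓖.prop X hX).union hμ h𝓑 hsec hε (h𝓖.mem X hX) h𝓑.empty_mem
        (by simpa [hμ.empty h𝓑] using mul_nonneg hε.le (hμ.nonneg X (h𝓖.mem X hX))),
      h𝓖.disjoint⟩
  refine ⟨{C ∪ ((A \ C) \ ⋃ X ∈ 𝓖, X)} ∪ 𝓖,
    (isPacking_singleton (h𝓑.union_mem hC hE) hCE).union h𝓖' ?_, ?_⟩
  · rw [Finset.set_biUnion_singleton, Set.disjoint_union_left]
    exact ⟨Set.disjoint_left.2 fun x hx hx' => (hsub' hx').2 hx, Set.disjoint_sdiff_left⟩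
  · rw [Finset.set_biUnion_union, Finset.set_biUnion_singleton, Set.union_assoc,
      Set.sdiff_union_of_subset hsub', Set.union_sdiff_cancel hCA]

end Measure

section RelBoolAlg

variable {X : Type*} {V : Set X} {S : Set (Set X)}

theorem RelBoolAlg.subset (hS : ∀ A ∈ S, A ⊆ V) {A : Set X} (hA : RelBoolAlg V S A) : A ⊆ V := by
  induction hA with
  | basic h => exact hS _ h
  | top => exact subset_rfl
  | compl _ _ => exact Set.sdiff_subset
  | inter _ _ ih _ => exact Set.inter_subset_left.trans ih

theorem RelBoolAlg.sdiff (hS : ∀ A ∈ S, A ⊆ V) {A C : Set X} (hA : RelBoolAlg V S A)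
    (hC : RelBoolAlg V S C) : RelBoolAlg V S (A \ C) := by
  have : A ∩ (V \ C) = A \ C := by
    rw [← Set.inter_sdiff_assoc, Set.inter_eq_self_of_subset_left (hA.subset hS)]
  exact this ▸ hA.inter hC.compl

theorem RelBoolAlg.empty : RelBoolAlg V S ∅ := by
  simpa using (RelBoolAlg.top (V := V) (S := S)).compl

theorem RelBoolAlg.isSetRing (hS : ∀ A ∈ S, A ⊆ V) : IsSetRing {A | RelBoolAlg V S A} where
  empty_mem := .empty
  union_mem A C hA hC := by
    have : V \ ((V \ A) \ C) = A ∪ C := by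
      rw [sdiff_sdiff, sdiff_sdiff_right_self]
      exact inf_of_le_right (sup_le (hA.subset hS) (hC.subset hS))
    exact Set.mem_ofPred_eq ▸ this ▸ (hA.compl.sdiff hS hC).compl
  sdiff_mem _ _ hA hC := hA.sdiff hS hC

/-- The atom of the algebra generated by the sets `{b ∈ W | R a b}`, `a ∈ F`, on which exactly
the sets indexed by `T` hold. -/
theorem RelBoolAlg.atom {Y : Type*} {W : Set Y} {S : Set (Set Y)} {R : X → Y → Prop}
    (hR : ∀ a, RelBoolAlg W S {b ∈ W | R a b}) (F : Finset X) (T : Set X) :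
    RelBoolAlg W S {b ∈ W | ∀ a ∈ F, R a b ↔ a ∈ T} := by
  classical
  induction F using Finset.induction_on with
  | empty => simpa using RelBoolAlg.top
  | insert a F _ ih =>
    by_cases ha : a ∈ T
    · convert ih.inter (hR a) using 1
      ext b
      simp only [Finset.forall_mem_insert, ha, iff_true, Set.mem_inter_iff, Set.mem_ofPred_eq]
      tauto
    · convert ih.inter (hR a).compl using 1
      ext b
      simp only [Finset.forall_mem_insert, ha, iff_false, Set.mem_inter_iff, Set.mem_sdiff,
        Set.mem_ofPred_eq]
      tauto

end RelBoolAlg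

section Definable

variable {L : FirstOrder.Language.{u, v}} {M : Type w} [L.Structure M] {P s t : Set M}

theorem DefOver.inter (hs : DefOver L M P s) (ht : DefOver L M P t) : DefOver L M P (s ∩ t) := by
  obtain ⟨k, φ, c, hc, rfl⟩ := hs
  obtain ⟨l, ψ, d, hd, rfl⟩ := ht
  refine ⟨k + l, φ.relabel (Sum.map id (Fin.castAdd l)) ⊓ ψ.relabel (Sum.map id (Fin.natAdd k)),
    Fin.append c d, Fin.addCases (by simpa using hc) (by simpa using hd), ?_⟩
  ext a
  simp only [Set.mem_inter_iff, Set.mem_ofPred_eq, FirstOrder.Language.Formula.realize_inf,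
    FirstOrder.Language.Formula.realize_relabel, Sum.elim_comp_map, Function.comp_id]
  have h1 : Fin.append c d ∘ Fin.castAdd l = c := by ext; simp
  have h2 : Fin.append c d ∘ Fin.natAdd k = d := by ext; simp
  rw [h1, h2]

theorem DefOver.compl (hs : DefOver L M P s) : DefOver L M P sᶜ := by
  obtain ⟨k, φ, c, hc, rfl⟩ := hs
  exact ⟨k, φ.not, c, hc, by ext; simp⟩

theorem DefOver.of_relBoolAlg {S : Set (Set M)} (hs : DefOver L M P s)
    (hS : ∀ A ∈ S, DefOver L M P A) (ht : RelBoolAlg s S t) : DefOver L M P t := by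
  induction ht with
  | basic h => exact hS _ h
  | top => exact hs
  | compl _ ih => exact hs.inter ih.compl
  | inter _ _ ih1 ih2 => exact ih1.inter ih2

theorem DefRelOver.fiber_right {r : M → M → Prop} (hr : DefRelOver L M P r) {b : M} (hb : b ∈ P) :
    DefOver L M P {a | r a b} := by
  obtain ⟨k, φ, c, hc, h⟩ := hr
  refine ⟨k + 1, φ.relabel (Sum.elim (Sum.elim Sum.inl fun _ => Sum.inr 0)
    fun j => Sum.inr j.succ), Fin.cons b c, Fin.cases (by simpa) (by simpa using hc), ?_⟩
  ext a
  rw [Set.mem_ofPred_eq, h, Set.mem_ofPred_eq, FirstOrder.Language.Formula.realize_relabel]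
  congr! 1
  ext ((i | i) | i) <;> simp

theorem DefRelOver.fiber_left {r : M → M → Prop} (hr : DefRelOver L M P r) {a : M} (ha : a ∈ P) :
    DefOver L M P {b | r a b} := by
  obtain ⟨k, φ, c, hc, h⟩ := hr
  refine ⟨k + 1, φ.relabel (Sum.elim (Sum.elim (fun _ => Sum.inr 0) Sum.inl)
    fun j => Sum.inr j.succ), Fin.cons a c, Fin.cases (by simpa) (by simpa using hc), ?_⟩
  ext b
  rw [Set.mem_ofPred_eq, h, Set.mem_ofPred_eq, FirstOrder.Language.Formula.realize_relabel]
  congr! 1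
  ext ((i | i) | i) <;> simp

end Definable

theorem stable_regularity_keisler_measure
    {L : FirstOrder.Language.{u, v}} {M : Type w} [L.Structure M]
    (V W : Set M) (R : M → M → Prop)
    (hV : DefOver L M Set.univ V) (hW : DefOver L M Set.univ W)
    (hR : DefRelOver L M Set.univ R)
    (hRVW : ∀ a b, R a b → a ∈ V ∧ b ∈ W)
    (k : ℕ) (hstable : IsKStable R k)
    (μ : Set M → ℝ) (hμ : IsKeislerMeasureOn L M V μ)
    (ε : ℝ) (hε : 0 < ε) :
    ∃ (n m : ℕ) (Vp : Fin n → Set M) (Wp : Fin m → Set M),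
      (⋃ i, Vp i) = V ∧ Pairwise (Function.onFun Disjoint Vp) ∧
      (⋃ j, Wp j) = W ∧ Pairwise (Function.onFun Disjoint Wp) ∧
      (∀ i, DefOver L M Set.univ (Vp i)) ∧
      (∀ j, DefOver L M Set.univ (Wp j)) ∧
      (∀ i, RelBoolAlg V {s | ∃ b ∈ W, s = {a ∈ V | R a b}} (Vp i)) ∧
      (∀ j, RelBoolAlg W {t | ∃ a ∈ V, t = {b ∈ W | R a b}} (Wp j)) ∧
      ∀ (i : Fin n) (j : Fin m),
        (∀ b ∈ Wp j, μ (Vp i \ {a | R a b}) ≤ ε * μ (Vp i)) ∨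
        (∀ b ∈ Wp j, μ (Vp i ∩ {a | R a b}) ≤ ε * μ (Vp i)) := by
  classical
  set SV : Set (Set M) := {s | ∃ b ∈ W, s = {a ∈ V | R a b}} with hSV
  set SW : Set (Set M) := {t | ∃ a ∈ V, t = {b ∈ W | R a b}} with hSW
  have hSVsub : ∀ A ∈ SV, A ⊆ V := by
    rintro _ ⟨b, -, rfl⟩
    exact Set.sep_subset _ _
  have hVdef : ∀ A, RelBoolAlg V SV A → DefOver L M Set.univ A := fun A hA =>
    hV.of_relBoolAlg (by
      rintro _ ⟨b, -, rfl⟩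
      exact hV.inter (hR.fiber_right (Set.mem_univ b))) hA
  have hWdef : ∀ A, RelBoolAlg W SW A → DefOver L M Set.univ A := fun A hA =>
    hW.of_relBoolAlg (by
      rintro _ ⟨a, -, rfl⟩
      exact hW.inter (hR.fiber_left (Set.mem_univ a))) hA
  have h𝓑 := RelBoolAlg.isSetRing hSVsub
  have hfin : IsFinAdd {A | RelBoolAlg V SV A} μ :=
    ⟨fun A hA => hμ.1 A (hVdef A hA) (hA.subset hSVsub), fun A hA C hC hd =>
      hμ.2.2 A C (hVdef A hA) (hVdef C hC) (hA.subset hSVsub) (hC.subset hSVsub) hd⟩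
  have hsec : ∀ A ∈ {A | RelBoolAlg V SV A}, ∀ b, A ∩ {a | R a b} ∈ {A | RelBoolAlg V SV A} := by
    intro A hA b
    by_cases hb : b ∈ W
    · have : A ∩ {a ∈ V | R a b} = A ∩ {a | R a b} :=
        Set.ext fun a => and_congr_right fun ha => and_iff_right (hA.subset hSVsub ha)
      exact this ▸ hA.inter (.basic ⟨b, hb, rfl⟩)
    · have : A ∩ {a | R a b} = ∅ :=
        Set.eq_empty_of_forall_notMem fun a ha => hb (hRVW a b ha.2).2
      rw [this]
      exact h𝓑.empty_mem
  have hWsec : ∀ a, RelBoolAlg W SW {b ∈ W | R a b} := by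
    intro a
    by_cases ha : a ∈ V
    · exact .basic ⟨a, ha, rfl⟩
    · have : {b ∈ W | R a b} = ∅ :=
        Set.eq_empty_of_forall_notMem fun b hb => ha (hRVW a b hb.2).1
      rw [this]
      exact .empty
  obtain ⟨𝓕, h𝓕, hU⟩ := hstable.exists_packing_eq hfin h𝓑 hsec (half_pos hε)
    (A := V) RelBoolAlg.top (by rw [hμ.2.1]; exact one_pos)
  have hprop := h𝓕.prop
  rw [mul_div_cancel₀ ε two_ne_zero] at hprop
  choose! D F hDF hD1 hD2 using hprop
  let F₀ : Finset M := 𝓕.biUnion F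
  let e := 𝓕.equivFin
  let e' := F₀.powerset.equivFin
  refine ⟨_, _, fun i => (e.symm i : Set M),
    fun j => {b ∈ W | ∀ a ∈ F₀, R a b ↔ a ∈ ((e'.symm j : Finset M) : Set M)},
    ?_, ?_, ?_, ?_, fun i => hVdef _ (h𝓕.mem _ (e.symm i).2),
    fun j => hWdef _ (RelBoolAlg.atom hWsec _ _), fun i => h𝓕.mem _ (e.symm i).2,
    fun j => RelBoolAlg.atom hWsec _ _, fun i j => ?_⟩
  · rw [e.symm.surjective.iUnion_comp (fun C => (C : Set M)), ← hU]
    exact Set.iUnion_subtype _ _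
  · intro i j hij
    exact h𝓕.disjoint (e.symm i).2 (e.symm j).2 fun h => hij (e.symm.injective (Subtype.ext h))
  · refine Set.Subset.antisymm (Set.iUnion_subset fun j => Set.sep_subset _ _) fun b hb => ?_
    refine Set.mem_iUnion.2 ⟨e' ⟨{a ∈ F₀ | R a b}, by simp⟩, hb, fun a ha => ?_⟩
    simp [ha]
  · intro i j hij
    refine Set.disjoint_left.2 fun b hb hb' => hij (e'.symm.injective (Subtype.ext ?_))
    ext a
    have hi := Finset.mem_powerset.1 (e'.symm i).2
    have hj := Finset.mem_powerset.1 (e'.symm j).2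
    by_cases ha : a ∈ F₀
    · exact (hb.2 a ha).symm.trans (hb'.2 a ha)
    · exact iff_of_false (fun h => ha (hi h)) fun h => ha (hj h)
  · have hC := (e.symm i).2
    have hmem : ∀ b b',
        (∀ a ∈ F₀, R a b ↔ a ∈ ((e'.symm j : Finset M) : Set M)) →
        (∀ a ∈ F₀, R a b' ↔ a ∈ ((e'.symm j : Finset M) : Set M)) →
        (b ∈ D (e.symm i) ↔ b' ∈ D (e.symm i)) := fun b b' hb hb' =>
      hDF _ hC b b' fun a ha =>
        have ha' : a ∈ F₀ := Finset.mem_biUnion.2 ⟨_, hC, ha⟩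
        (hb a ha').trans (hb' a ha').symm
    by_cases h : ∃ b ∈ W, (∀ a ∈ F₀, R a b ↔ a ∈ ((e'.symm j : Finset M) : Set M)) ∧
        b ∈ D (e.symm i)
    · obtain ⟨b', -, hb', hbD⟩ := h
      exact Or.inl fun b hb => hD1 _ hC b ((hmem b b' hb.2 hb').2 hbD)
    · exact Or.inr fun b hb => hD2 _ hC b fun hbD => h ⟨b, hb.1, hb.2, hbD⟩
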